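/- For every integer n ≥ 7, there exists a CDCC graph Γ_n with exactly n vertices such that all powers I(Γ_n)^s with s ≥ 2 have linear quotients. -/

import Mathlib

open MvPolynomial

/-- An ideal is generated by a subset of the variables. -/
def genByVars {K : Type*} [Field K] {σ : Type*} (J : Ideal (MvPolynomial σ K)) : Prop :=
  ∃ S : Set σ, J = Ideal.span ((fun i => (X i : MvPolynomial σ K)) '' S)

/-- An equigenerated monomial ideal has linear quotients: there is an ordering of a
minimal monomial generating system (an antichain of exponent vectors) such that each
successive colon ideal is generated by variables. -/
def HasLinearQuotients {K : Type*} [Field K] {σ : Type*} (I : Ideal (MvPolynomial σ K)) : Prop :=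
  ∃ (r : ℕ) (d : Fin r → (σ →₀ ℕ)),
    (∀ i j : Fin r, i ≠ j → ¬ d i ≤ d j) ∧
    Ideal.span (Set.range fun i => (monomial (d i) (1 : K))) = I ∧
    ∀ i : Fin r,
      genByVars (Submodule.colon
        (Ideal.span ((fun j => (monomial (d j) (1 : K))) '' {j | j < i}))
        (Ideal.span {(monomial (d i) (1 : K))}))

/-- A graph is gapfree if any two disjoint edges are joined by an edge meeting both. -/
def Gapfree {V : Type*} (G : SimpleGraph V) : Prop :=
  ∀ a b c d : V, G.Adj a b → G.Adj c d → ({a, b} : Set V) ∩ {c, d} = ∅ →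
    ∃ u v : V, G.Adj u v ∧ (({u, v} : Set V) ∩ {a, b}).Nonempty ∧
      (({u, v} : Set V) ∩ {c, d}).Nonempty

/-- The edge ideal of a graph. -/
noncomputable def edgeIdeal (K : Type*) [Field K] {V : Type*} (G : SimpleGraph V) :
    Ideal (MvPolynomial V K) :=
  Ideal.span {m | ∃ a b : V, G.Adj a b ∧ m = X a * X b}

/-- `G` contains an induced subgraph isomorphic to `H`. -/
def ContainsInduced {V W : Type*} (G : SimpleGraph V) (H : SimpleGraph W) : Prop :=
  ∃ s : Set V, Nonempty ((G.induce s) ≃g H)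

/-- The 5-cycle on `Fin 5`. -/
def cycle5 : SimpleGraph (Fin 5) :=
  SimpleGraph.fromRel (fun i j => j = i + 1)

/-- The 4-cycle on `Fin 4`. -/
def cycle4 : SimpleGraph (Fin 4) :=
  SimpleGraph.fromRel (fun i j => j = i + 1)

/-- The cricket: triangle `cde` with two pendant vertices attached to `c`. -/
def cricket : SimpleGraph (Fin 5) :=
  SimpleGraph.fromRel (fun i j =>
    (i = 0 ∧ j = 2) ∨ (i = 1 ∧ j = 2) ∨ (i = 2 ∧ j = 3) ∨ (i = 2 ∧ j = 4) ∨ (i = 3 ∧ j = 4))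

/-- The diamond: `K_4` minus an edge. -/
def diamond : SimpleGraph (Fin 4) :=
  (⊤ : SimpleGraph (Fin 4)).deleteEdges {s(0, 1)}

/-- A CDCC graph: gapfree, containing a cricket, a diamond, `C_4` and `C_5` as induced
subgraphs. -/
def IsCDCC {V : Type*} (G : SimpleGraph V) : Prop :=
  Gapfree G ∧ ContainsInduced G cricket ∧ ContainsInduced G diamond ∧
    ContainsInduced G cycle4 ∧ ContainsInduced G cycle5

set_option linter.unnecessarySeqFocus false
set_option linter.unusedTactic false

/-- Class-level polytope. -/
def PP (s : ℕ) (v : Fin 6 → ℕ) : Prop :=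
  v 0 + v 1 + v 2 + v 3 + v 4 + v 5 = 2 * s ∧ v 0 ≤ s ∧ v 1 + v 2 ≤ s ∧ v 2 + v 3 ≤ s ∧
    v 3 + v 4 ≤ s ∧ v 4 + v 5 ≤ s ∧ v 5 + v 1 ≤ s

/-- The exceptional region. -/
def reg (v : Fin 6 → ℕ) : Prop := v 0 = 0 ∧ (v 3 = 0 ∨ v 5 = 0)

abbrev KT := ℤ ×ₗ ℤ ×ₗ ℤ ×ₗ ℤ ×ₗ ℤ ×ₗ ℤ

open Classical in
/-- The ordering key: smaller keys come first. -/
noncomputable def KK (s : ℕ) (v : Fin 6 → ℕ) : KT :=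
  if reg v then
    toLex (-(v 0 : ℤ), toLex (1, toLex ((v 4 : ℤ), toLex
      (if v 4 = s ∧ v 1 = 0 then 1 else 0, toLex (-(v 5 : ℤ),
        if v 3 = 0 then -(v 2 : ℤ) else -(v 1 : ℤ))))))
  else
    toLex (-(v 0 : ℤ), toLex (0, toLex (-(v 1 : ℤ), toLex
      (-(v 5 : ℤ), toLex (-(v 4 : ℤ), -(v 3 : ℤ))))))

lemma KK_lt_of (s : ℕ) (v w : Fin 6 → ℕ) (h : v 0 < w 0) : KK s w < KK s v := by
  unfold KK
  split_ifs <;> simp only [Prod.Lex.toLex_lt_toLex] <;> omega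

lemma KK_lt_01 (s : ℕ) (v w : Fin 6 → ℕ) (hw : ¬ reg w) (hv : reg v) (h : v 0 = w 0) :
    KK s w < KK s v := by
  unfold KK
  rw [if_neg hw, if_pos hv]
  simp only [Prod.Lex.toLex_lt_toLex]; omega

lemma KK_lt_10 (s : ℕ) (v w : Fin 6 → ℕ) (hw : reg w) (hv : ¬ reg v) :
    KK s w < KK s v ↔ v 0 < w 0 := by
  unfold KK
  rw [if_pos hw, if_neg hv]
  simp only [Prod.Lex.toLex_lt_toLex]; omega

lemma KK_lt_00 (s : ℕ) (v w : Fin 6 → ℕ) (hw : ¬ reg w) (hv : ¬ reg v) :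
    KK s w < KK s v ↔ (v 0 < w 0 ∨ v 0 = w 0 ∧ (v 1 < w 1 ∨ v 1 = w 1 ∧
      (v 5 < w 5 ∨ v 5 = w 5 ∧ (v 4 < w 4 ∨ v 4 = w 4 ∧ v 3 < w 3)))) := by
  unfold KK
  rw [if_neg hw, if_neg hv]
  simp only [Prod.Lex.toLex_lt_toLex, lt_self_iff_false, true_and, false_or]; omega

lemma KK_lt_11 (s : ℕ) (v w : Fin 6 → ℕ) (hw : reg w) (hv : reg v) :
    KK s w < KK s v ↔ (w 4 < v 4 ∨ w 4 = v 4 ∧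
      ((¬ (w 4 = s ∧ w 1 = 0) ∧ (v 4 = s ∧ v 1 = 0)) ∨
        ((w 4 = s ∧ w 1 = 0) ↔ (v 4 = s ∧ v 1 = 0)) ∧
      (v 5 < w 5 ∨ v 5 = w 5 ∧
        (if w 3 = 0 then -(w 2 : ℤ) else -(w 1 : ℤ)) <
        (if v 3 = 0 then -(v 2 : ℤ) else -(v 1 : ℤ))))) := by
  unfold KK
  rw [if_pos hw, if_pos hv]
  have h1 := hw.1
  have h2 := hv.1
  simp only [Prod.Lex.toLex_lt_toLex]
  generalize (if w 3 = 0 then -(w 2 : ℤ) else -(w 1 : ℤ)) = A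
  generalize (if v 3 = 0 then -(v 2 : ℤ) else -(v 1 : ℤ)) = B
  simp only [h1, h2, lt_self_iff_false, true_and, false_or]
  by_cases h3 : (w 4 = s ∧ w 1 = 0) <;> by_cases h4 : (v 4 = s ∧ v 1 = 0)
  · rw [if_pos h3, if_pos h4]
    simp only [lt_self_iff_false, true_and, false_or, h3, h4, not_true_eq_false, false_and, and_self]; omega
  · rw [if_pos h3, if_neg h4]; omega
  · rw [if_neg h3, if_pos h4]; omega
  · rw [if_neg h3, if_neg h4]
    simp only [lt_self_iff_false, true_and, false_or, h3, h4, and_false]; omega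

lemma KK_inj (s : ℕ) (v w : Fin 6 → ℕ) (hv : PP s v) (hw : PP s w) (h : KK s v = KK s w) :
    v = w := by
  suffices H : v 0 = w 0 ∧ v 1 = w 1 ∧ v 2 = w 2 ∧ v 3 = w 3 ∧ v 4 = w 4 ∧ v 5 = w 5 by
    funext k
    fin_cases k <;> simp <;> omega
  unfold PP at hv hw
  by_cases h1 : reg v <;> by_cases h2 : reg w
  · unfold KK at h
    rw [if_pos h1, if_pos h2] at h
    unfold reg at h1 h2
    simp only [EmbeddingLike.apply_eq_iff_eq, Prod.mk.injEq] at h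
    obtain ⟨a1, a2, a3, a4, a5, a6⟩ := h
    split_ifs at a6 <;> omega
  · unfold KK at h
    rw [if_pos h1, if_neg h2] at h
    simp at h
  · unfold KK at h
    rw [if_neg h1, if_pos h2] at h
    simp at h
  · unfold KK at h
    rw [if_neg h1, if_neg h2] at h
    simp only [EmbeddingLike.apply_eq_iff_eq, Prod.mk.injEq] at h
    omega

/-- move one unit from `j` to `i`. -/
def mv (v : Fin 6 → ℕ) (i j : Fin 6) : Fin 6 → ℕ :=
  fun k => v k + (if k = i then 1 else 0) - (if k = j then 1 else 0)

/-- The exchange step. -/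
def Good (s : ℕ) (u v : Fin 6 → ℕ) : Prop :=
  ∃ i j, i ≠ j ∧ v i < u i ∧ 0 < v j ∧ PP s (mv v i j) ∧ KK s (mv v i j) < KK s v

set_option maxHeartbeats 2000000 in
lemma exch0 (s : ℕ) (u v : Fin 6 → ℕ) (hu : PP s u) (hv : PP s v)
    (ru : ¬ reg u) (rv : ¬ reg v) (h0 : v 0 = u 0) (h : KK s u < KK s v) : Good s u v := by
  rw [KK_lt_00 s v u ru rv] at h
  have main : ∀ i j, i ≠ j → v i < u i → 0 < v j → PP s (mv v i j) → ¬ reg (mv v i j) →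
    (v 0 < mv v i j 0 ∨ v 0 = mv v i j 0 ∧ (v 1 < mv v i j 1 ∨ v 1 = mv v i j 1 ∧
      (v 5 < mv v i j 5 ∨ v 5 = mv v i j 5 ∧ (v 4 < mv v i j 4 ∨ v 4 = mv v i j 4 ∧ v 3 < mv v i j 3))))
    → Good s u v := by
    intro i j h1 h2 h3 h4 h5 h6
    exact ⟨i, j, h1, h2, h3, h4, (KK_lt_00 s v _ h5 rv).2 h6⟩
  clear * - main hu hv ru rv h0 h
  unfold PP reg at *
  obtain h | ⟨-, h | ⟨e1, h | ⟨e5, h | ⟨e4, h⟩⟩⟩⟩ := h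
  · omega
  · by_cases f12 : v 1 + v 2 < s <;> by_cases f51 : v 5 + v 1 < s
    · by_cases c : 0 < v 2
      · apply main 1 2 <;> (try simp [mv]) <;> omega
      · by_cases c : 0 < v 4
        · apply main 1 4 <;> (try simp [mv]) <;> omega
        · apply main 1 3 <;> (try simp [mv]) <;> omega
    · apply main 1 5 <;> (try simp [mv]) <;> omega
    · apply main 1 2 <;> (try simp [mv]) <;> omega
    · by_cases c : v 4 < u 4
      · apply main 4 2 <;> (try simp [mv]) <;> omega
      · apply main 3 2 <;> (try simp [mv]) <;> omega
  · by_cases f45 : v 4 + v 5 < s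
    · by_cases c : 0 < v 2
      · apply main 5 2 <;> (try simp [mv]) <;> omega
      · by_cases c : 0 < v 4
        · apply main 5 4 <;> (try simp [mv]) <;> omega
        · apply main 5 3 <;> (try simp [mv]) <;> omega
    · apply main 5 4 <;> (try simp [mv]) <;> omega
  · by_cases f34 : v 3 + v 4 < s
    · by_cases c : 0 < v 2
      · apply main 4 2 <;> (try simp [mv]) <;> omega
      · apply main 4 3 <;> (try simp [mv]) <;> omega
    · apply main 4 3 <;> (try simp [mv]) <;> omega
  · apply main 3 2 <;> (try simp [mv]) <;> omega

set_option maxHeartbeats 2000000 in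
lemma exch1 (s : ℕ) (hs : 2 ≤ s) (u v : Fin 6 → ℕ) (hu : PP s u) (hv : PP s v)
    (rv : reg v) (h0 : v 0 = u 0) (h : KK s u < KK s v) : Good s u v := by
  have h' : reg u → _ := fun ru => (KK_lt_11 s v u ru rv).1 h
  have m0 : ∀ i j, i ≠ j → v i < u i → 0 < v j → PP s (mv v i j) → ¬ reg (mv v i j) →
    (v 0 = mv v i j 0) → Good s u v := by
    intro i j h1 h2 h3 h4 h5 h6
    exact ⟨i, j, h1, h2, h3, h4, KK_lt_01 s v _ h5 rv h6⟩
  have m1 : ∀ i j, i ≠ j → v i < u i → 0 < v j → PP s (mv v i j) → reg (mv v i j) →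
    mv v i j 4 < v 4 → Good s u v := by
    intro i j h1 h2 h3 h4 h5 h6
    exact ⟨i, j, h1, h2, h3, h4, (KK_lt_11 s v _ h5 rv).2 (Or.inl h6)⟩
  have m2 : ∀ i j, i ≠ j → v i < u i → 0 < v j → PP s (mv v i j) → reg (mv v i j) →
    mv v i j 4 = v 4 → ¬ (v 4 = s ∧ mv v i j 1 = 0) →
    (v 4 = s ∧ v 1 = 0 ∨ (mv v i j 5 = v 5 ∧ mv v i j 3 = v 3 ∧
      (v 3 = 0 ∧ v 2 < mv v i j 2 ∨ v 3 ≠ 0 ∧ v 1 < mv v i j 1))) → Good s u v := by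
    intro i j h1 h2 h3 h4 h5 h6 h7 h8
    refine ⟨i, j, h1, h2, h3, h4, (KK_lt_11 s v _ h5 rv).2 (Or.inr ⟨h6, ?_⟩)⟩
    by_cases h9 : v 4 = s ∧ v 1 = 0
    · left; rw [h6]; exact ⟨h7, h9⟩
    · right
      obtain h8 | ⟨h8, h10, h11⟩ := h8
      · exact absurd h8 h9
      · rw [h6, h10]
        refine ⟨by tauto, Or.inr ⟨h8.symm, ?_⟩⟩
        split_ifs <;> omega
  clear h
  clear * - m0 m1 m2 hu hv h' rv h0 hs
  unfold PP reg at *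
  by_cases c3 : v 3 = 0 <;> by_cases c5 : v 5 = 0
  · by_cases c1 : v 1 = 0
    · by_cases d : 0 < u 5
      · apply m1 5 4 <;> (try simp [mv]) <;> omega
      · apply m2 1 2 <;> (try simp [mv]) <;> omega
    · by_cases c2 : v 2 = 0
      · by_cases d : 0 < u 3
        · apply m1 3 4 <;> (try simp [mv]) <;> omega
        · have : 0 < u 2 := by
            by_contra hne
            have h'' := h' (by omega)
            rw [if_pos (by omega), if_pos c3] at h''
            omega
          apply m2 2 1 <;> (try simp [mv]) <;> omega
      · by_cases d : 0 < u 5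
        · apply m1 5 4 <;> (try simp [mv]) <;> omega
        · by_cases d : 0 < u 3
          · apply m1 3 4 <;> (try simp [mv]) <;> omega
          · have h'' := h' (by omega)
            rw [if_pos (by omega), if_pos c3] at h''
            apply m2 2 1 <;> (try simp [mv]) <;> omega
  · by_cases d : 0 < u 3
    · apply m0 3 2 <;> (try simp [mv]) <;> omega
    · have h'' := h' (by omega)
      rw [if_pos (by omega), if_pos c3] at h''
      by_cases e : u 4 < v 4 ∧ v 5 < v 2
      · apply m1 5 4 <;> (try simp [mv]) <;> omega
      · apply m2 2 1 <;> (try simp [mv]) <;> omega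
  · by_cases d : 0 < u 5
    · apply m0 5 1 <;> (try simp [mv]) <;> omega
    · have h'' := h' (by omega)
      rw [if_neg c3] at h''
      by_cases d3 : u 3 = 0
      · rw [if_pos d3] at h''
        by_cases e : u 4 < v 4 ∧ v 3 < v 1
        · omega
        · omega
      · rw [if_neg d3] at h''
        by_cases e : u 4 < v 4 ∧ v 3 < v 1
        · apply m1 3 4 <;> (try simp [mv]) <;> omega
        · apply m2 1 2 <;> (try simp [mv]) <;> omega
  · omega

lemma exch (s : ℕ) (hs : 2 ≤ s) (u v : Fin 6 → ℕ) (hu : PP s u) (hv : PP s v)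
    (h : KK s u < KK s v) : Good s u v := by
  by_cases h0 : v 0 < u 0
  · have main : ∀ j, 0 ≠ j → 0 < v j → PP s (mv v 0 j) → v 0 < mv v 0 j 0 → Good s u v := by
      intro j h1 h3 h4 h5
      exact ⟨0, j, h1, h0, h3, h4, KK_lt_of s v _ h5⟩
    clear * - main hu hv h0
    unfold PP at *
    by_cases c1 : 0 < v 1
    · apply main 1 <;> (try simp [mv]) <;> omega
    by_cases c2 : 0 < v 2
    · apply main 2 <;> (try simp [mv]) <;> omega
    by_cases c3 : 0 < v 3
    · apply main 3 <;> (try simp [mv]) <;> omega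
    by_cases c4 : 0 < v 4
    · apply main 4 <;> (try simp [mv]) <;> omega
    · apply main 5 <;> (try simp [mv]) <;> omega
  · have h0' : v 0 = u 0 := by
      by_contra hne
      exact lt_asymm h (KK_lt_of s u v (by omega))
    by_cases rv : reg v
    · exact exch1 s hs u v hu hv rv h0' h
    · by_cases ru : reg u
      · exact absurd ((KK_lt_10 s v u ru rv).1 h) h0
      · exact exch0 s u v hu hv ru rv h0' h

/-- Adjacency in the wheel `W_5` (hub `0`; `i, j` in the rim are adjacent iff they are not
cyclically consecutive in `1, 2, 3, 4, 5`). -/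
def wadj (i j : Fin 6) : Prop :=
  (i = 0 ∧ j ≠ 0) ∨ (j = 0 ∧ i ≠ 0) ∨ (i = 1 ∧ j = 3) ∨ (i = 3 ∧ j = 1) ∨ (i = 1 ∧ j = 4) ∨
    (i = 4 ∧ j = 1) ∨ (i = 2 ∧ j = 4) ∨ (i = 4 ∧ j = 2) ∨ (i = 2 ∧ j = 5) ∨ (i = 5 ∧ j = 2) ∨
    (i = 3 ∧ j = 5) ∨ (i = 5 ∧ j = 3)

instance : DecidableRel wadj := fun i j => by unfold wadj; infer_instance

lemma wadj_symm (i j : Fin 6) (h : wadj i j) : wadj j i := by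
  revert i j; decide

/-- indicator vector -/
def ind (i k : Fin 6) : ℕ := if k = i then 1 else 0

set_option maxHeartbeats 4000000 in
lemma PP_add (s : ℕ) (D D' : Fin 6 → ℕ) (i j : Fin 6) (h : wadj i j)
    (hD : ∀ k, D' k = D k + ind i k + ind j k) (hP : PP s D) : PP (s + 1) D' := by
  have h0 := hD 0
  have h1 := hD 1
  have h2 := hD 2
  have h3 := hD 3
  have h4 := hD 4
  have h5 := hD 5
  clear hD
  unfold PP at *
  unfold wadj at h
  fin_cases i <;> fin_cases j <;> simp [ind] at h h0 h1 h2 h3 h4 h5 <;> omega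

set_option maxHeartbeats 4000000 in
lemma PP_sub (s : ℕ) (D : Fin 6 → ℕ) (hP : PP (s + 1) D) :
    ∃ i j, wadj i j ∧ 0 < D i ∧ 0 < D j ∧ PP s (fun k => D k - ind i k - ind j k) := by
  have key : ∀ i j, wadj i j → 0 < D i → 0 < D j → PP s (fun k => D k - ind i k - ind j k) →
    ∃ i j, wadj i j ∧ 0 < D i ∧ 0 < D j ∧ PP s (fun k => D k - ind i k - ind j k) :=
    fun i j h1 h2 h3 h4 => ⟨i, j, h1, h2, h3, h4⟩
  unfold PP at *
  by_cases h0 : D 0 = 0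
  · by_cases c : D 4 + D 5 ≤ s
    · apply key 1 3 <;> first | decide | ((try simp [ind]) <;> omega)
    · by_cases c : D 2 + D 3 ≤ s
      · apply key 1 4 <;> first | decide | ((try simp [ind]) <;> omega)
      · by_cases c : D 5 + D 1 ≤ s
        · apply key 2 4 <;> first | decide | ((try simp [ind]) <;> omega)
        · by_cases c : D 3 + D 4 ≤ s
          · apply key 2 5 <;> first | decide | ((try simp [ind]) <;> omega)
          · apply key 3 5 <;> first | decide | ((try simp [ind]) <;> omega)
  · by_cases c : s < D 1 + D 2
    · by_cases c : s < D 2 + D 3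
      · apply key 0 2 <;> first | decide | ((try simp [ind]) <;> omega)
      · by_cases c : s < D 5 + D 1
        · apply key 0 1 <;> first | decide | ((try simp [ind]) <;> omega)
        · by_cases c : 0 < D 1
          · apply key 0 1 <;> first | decide | ((try simp [ind]) <;> omega)
          · apply key 0 2 <;> first | decide | ((try simp [ind]) <;> omega)
    · by_cases c : s < D 2 + D 3
      · by_cases c : s < D 3 + D 4
        · apply key 0 3 <;> first | decide | ((try simp [ind]) <;> omega)
        · by_cases c : 0 < D 2
          · apply key 0 2 <;> first | decide | ((try simp [ind]) <;> omega)
          · apply key 0 3 <;> first | decide | ((try simp [ind]) <;> omega)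
      · by_cases c : s < D 3 + D 4
        · by_cases c : s < D 4 + D 5
          · apply key 0 4 <;> first | decide | ((try simp [ind]) <;> omega)
          · by_cases c : 0 < D 3
            · apply key 0 3 <;> first | decide | ((try simp [ind]) <;> omega)
            · apply key 0 4 <;> first | decide | ((try simp [ind]) <;> omega)
        · by_cases c : s < D 4 + D 5
          · by_cases c : s < D 5 + D 1
            · apply key 0 5 <;> first | decide | ((try simp [ind]) <;> omega)
            · by_cases c : 0 < D 4
              · apply key 0 4 <;> first | decide | ((try simp [ind]) <;> omega)
              · apply key 0 5 <;> first | decide | ((try simp [ind]) <;> omega)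
          · by_cases c : s < D 5 + D 1
            · by_cases c : 0 < D 5
              · apply key 0 5 <;> first | decide | ((try simp [ind]) <;> omega)
              · apply key 0 1 <;> first | decide | ((try simp [ind]) <;> omega)
            · by_cases c : 0 < D 1
              · apply key 0 1 <;> first | decide | ((try simp [ind]) <;> omega)
              · by_cases c : 0 < D 2
                · apply key 0 2 <;> first | decide | ((try simp [ind]) <;> omega)
                · by_cases c : 0 < D 3
                  · apply key 0 3 <;> first | decide | ((try simp [ind]) <;> omega)
                  · by_cases c : 0 < D 4
                    · apply key 0 4 <;> first | decide | ((try simp [ind]) <;> omega)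
                    · apply key 0 5 <;> first | decide | ((try simp [ind]) <;> omega)

lemma colon_vars {K : Type*} [Field K] {σ : Type*} (A : Set (σ →₀ ℕ)) (v : σ →₀ ℕ)
    (hex : ∀ u ∈ A, ∃ w ∈ A, ∃ p, v p < u p ∧ ∃ q, w + Finsupp.single q 1 = v + Finsupp.single p 1) :
    genByVars (Submodule.colon (Ideal.span ((fun j => (monomial j (1 : K))) '' A))
      (Ideal.span {(monomial v (1 : K))})) := by
  refine ⟨{p | ∃ w ∈ A, ∃ q, w + Finsupp.single q 1 = v + Finsupp.single p 1}, ?_⟩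
  apply le_antisymm
  · intro f hf
    have h1 : f * monomial v (1 : K) ∈ Ideal.span ((fun j => (monomial j (1 : K))) '' A) := by
      have := Submodule.mem_colon.1 hf (monomial v 1) (Ideal.subset_span rfl)
      simpa using this
    rw [mem_ideal_span_monomial_image] at h1
    rw [mem_ideal_span_X_image]
    intro m hm
    obtain ⟨u, hu, hle⟩ := h1 (m + v) (by
      rw [mem_support_iff] at hm ⊢
      rw [coeff_mul_monomial]; simpa using hm)
    obtain ⟨w, hw, p, hp, q, hq⟩ := hex u hu
    refine ⟨p, ⟨w, hw, q, hq⟩, ?_⟩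
    have := hle p
    simp only [Finsupp.add_apply] at this
    omega
  · rw [Ideal.span_le]
    rintro _ ⟨p, ⟨w, hw, q, hq⟩, rfl⟩
    rw [SetLike.mem_coe, Submodule.mem_colon]
    intro g hg
    obtain ⟨c, rfl⟩ := Ideal.mem_span_singleton'.1 hg
    have h2 : (X p : MvPolynomial σ K) • (c * monomial v (1 : K))
        = (c * X q) * monomial w (1 : K) := by
      have e1 : (X p : MvPolynomial σ K) * monomial v (1 : K) = monomial (v + Finsupp.single p 1) 1 := by
        rw [X, monomial_mul, add_comm, one_mul]
      have e2 : (X q : MvPolynomial σ K) * monomial w (1 : K) = monomial (v + Finsupp.single p 1) 1 := by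
        rw [X, monomial_mul, add_comm, one_mul, hq]
      rw [smul_eq_mul, mul_left_comm, e1, mul_assoc, e2]
    rw [h2]
    exact Ideal.mul_mem_left _ _ (Ideal.subset_span ⟨w, hw, rfl⟩)

lemma lq_of_exchange {K : Type*} [Field K] {σ : Type*} (M : Finset (σ →₀ ℕ)) (N : ℕ)
    (hdeg : ∀ d ∈ M, d.degree = N) {α : Type*} [LinearOrder α] (key : (σ →₀ ℕ) → α)
    (inj : ∀ u ∈ M, ∀ v ∈ M, key u = key v → u = v)
    (hex : ∀ u ∈ M, ∀ v ∈ M, key u < key v → ∃ w ∈ M, key w < key v ∧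
      ∃ p, v p < u p ∧ ∃ q, w + Finsupp.single q 1 = v + Finsupp.single p 1) :
    HasLinearQuotients (Ideal.span ((fun d => monomial d (1 : K)) '' (M : Set (σ →₀ ℕ)))) := by
  classical
  let T := M.image key
  let e := T.orderIsoOfFin rfl
  have hpre : ∀ i, ∃ d ∈ M, key d = (e i : α) := fun i => Finset.mem_image.1 (e i).2
  choose d hdM hdk using hpre
  have hsurj : ∀ u ∈ M, ∃ i, d i = u := by
    intro u hu
    refine ⟨e.symm ⟨key u, Finset.mem_image_of_mem _ hu⟩, inj _ (hdM _) _ hu ?_⟩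
    rw [hdk]; simp
  have hlt : ∀ i j, key (d i) < key (d j) ↔ i < j := by
    intro i j
    rw [hdk, hdk, Subtype.coe_lt_coe, e.lt_iff_lt]
  refine ⟨_, d, ?_, ?_, ?_⟩
  · intro i j hij hle
    apply hij
    have h1 : d i = d j := by
      obtain ⟨c, hc⟩ := le_iff_exists_add.1 hle
      have h2 := hdeg _ (hdM i)
      have h3 := hdeg _ (hdM j)
      rw [hc, map_add, h2] at h3
      have : c.degree = 0 := by omega
      rw [Finsupp.degree_eq_zero_iff] at this
      rw [hc, this, add_zero]
    have h4 := hdk i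
    rw [h1, hdk j] at h4
    exact (e.injective (Subtype.ext h4)).symm
  · congr 1
    ext f
    constructor
    · rintro ⟨i, rfl⟩
      exact ⟨d i, hdM i, rfl⟩
    · rintro ⟨u, hu, rfl⟩
      obtain ⟨i, rfl⟩ := hsurj u hu
      exact ⟨i, rfl⟩
  · intro i
    have := colon_vars (K := K) (d '' {j | j < i}) (d i) (by
      rintro _ ⟨j, hj, rfl⟩
      obtain ⟨w, hw, hk, h⟩ := hex _ (hdM j) _ (hdM i) ((hlt _ _).2 hj)
      obtain ⟨l, rfl⟩ := hsurj w hw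
      exact ⟨d l, ⟨l, (hlt _ _).1 hk, rfl⟩, h⟩)
    rwa [Set.image_image] at this

/-- class sums -/
def cs {σ : Type*} [Fintype σ] (π : σ → Fin 6) (d : σ →₀ ℕ) (k : Fin 6) : ℕ :=
  ∑ i with π i = k, d i

lemma cs_add {σ : Type*} [Fintype σ] (π : σ → Fin 6) (d e : σ →₀ ℕ) (k : Fin 6) :
    cs π (d + e) k = cs π d k + cs π e k := by
  simp [cs, Finset.sum_add_distrib]

lemma cs_single {σ : Type*} [Fintype σ] (π : σ → Fin 6) (p : σ) (k : Fin 6) :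
    cs π (Finsupp.single p 1) k = ind (π p) k := by
  classical
  unfold cs ind
  rw [Finset.sum_filter]
  by_cases h : k = π p
  · subst h
    rw [Finset.sum_eq_single p]
    · simp
    · intro b _ hb
      simp [Finsupp.single_apply, hb.symm]
    · simp
  · rw [if_neg h]
    apply Finset.sum_eq_zero
    intro x _
    by_cases hx : p = x
    · subst hx; rw [if_neg (fun h' => h h'.symm)]
    · simp [Finsupp.single_apply, hx]

lemma cs_total {σ : Type*} [Fintype σ] (π : σ → Fin 6) (d : σ →₀ ℕ) :
    d.degree = cs π d 0 + cs π d 1 + cs π d 2 + cs π d 3 + cs π d 4 + cs π d 5 := by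
  rw [Finsupp.degree_eq_sum, ← Finset.sum_fiberwise Finset.univ π]
  rw [Fin.sum_univ_six]
  rfl

lemma cs_pos {σ : Type*} [Fintype σ] (π : σ → Fin 6) (d : σ →₀ ℕ) (k : Fin 6) (h : 0 < cs π d k) :
    ∃ p, π p = k ∧ 0 < d p := by
  by_contra hne
  push Not at hne
  have : cs π d k = 0 := by
    apply Finset.sum_eq_zero
    intro x hx
    have := hne x (by simpa using hx)
    omega
  omega

lemma cs_lt {σ : Type*} [Fintype σ] (π : σ → Fin 6) (d e : σ →₀ ℕ) (k : Fin 6)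
    (h : cs π d k < cs π e k) : ∃ p, π p = k ∧ d p < e p := by
  obtain ⟨i, hi, h⟩ := Finset.exists_lt_of_sum_lt h
  exact ⟨i, by simpa using hi, h⟩

lemma exists_sub {σ : Type*} (d : σ →₀ ℕ) (p : σ) (h : 0 < d p) :
    ∃ e : σ →₀ ℕ, d = e + Finsupp.single p 1 := by
  classical
  refine ⟨d - Finsupp.single p 1, ?_⟩
  rw [tsub_add_cancel_of_le]
  intro q
  by_cases hq : p = q
  · subst hq; simp; omega
  · simp [Finsupp.single_apply, hq]

/-- blow-up of the wheel -/
def gph {σ : Type*} (π : σ → Fin 6) : SimpleGraph σ where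
  Adj p q := wadj (π p) (π q)
  symm := ⟨fun p q h => wadj_symm _ _ h⟩
  loopless := ⟨fun p h => by
    have : ∀ i, ¬ wadj i i := by decide
    exact this _ h⟩

lemma edge_pow {K : Type*} [Field K] {σ : Type*} [Fintype σ] (π : σ → Fin 6) (s : ℕ) :
    (edgeIdeal K (gph π)) ^ s =
      Ideal.span ((fun d => monomial d (1 : K)) '' {d | PP s (cs π d)}) := by
  classical
  induction s with
  | zero =>
    rw [pow_zero, Ideal.one_eq_top, eq_comm, Ideal.eq_top_iff_one]
    apply Ideal.subset_span
    refine ⟨0, ?_, rfl⟩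
    simp [PP, cs]
  | succ s ih =>
    rw [pow_succ, ih, edgeIdeal, Ideal.span_mul_span']
    congr 1
    ext f
    constructor
    · rintro ⟨_, ⟨d, hd, rfl⟩, _, ⟨a, b, hab, rfl⟩, rfl⟩
      refine ⟨d + (Finsupp.single a 1 + Finsupp.single b 1), ?_, ?_⟩
      · refine PP_add s (cs π d) _ (π a) (π b) hab ?_ hd
        intro k
        rw [cs_add, cs_add, cs_single, cs_single, add_assoc]
      · simp [X, monomial_mul]
    · rintro ⟨d, hd, rfl⟩
      obtain ⟨i, j, hij, hi, hj, hP⟩ := PP_sub s _ hd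
      obtain ⟨p, rfl, hp⟩ := cs_pos π d i hi
      obtain ⟨q, rfl, hq⟩ := cs_pos π d j hj
      have hpq : p ≠ q := by
        rintro rfl
        have : ∀ i, ¬ wadj i i := by decide
        exact this _ hij
      obtain ⟨e, rfl⟩ := exists_sub d p hp
      obtain ⟨e, rfl⟩ := exists_sub e q (by simpa [Finsupp.single_apply, hpq] using hq)
      refine ⟨_, ⟨e, ?_, rfl⟩, _, ⟨p, q, hij, rfl⟩, ?_⟩
      · change PP s (cs π e)
        convert hP using 1
        funext k
        rw [cs_add, cs_add, cs_single, cs_single]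
        omega
      · simp only [X, monomial_mul, mul_one]
        rw [show e + (Finsupp.single p 1 + Finsupp.single q 1)
          = e + Finsupp.single q 1 + Finsupp.single p 1 by abel]

lemma lq_main {K : Type*} [Field K] {σ : Type*} [Fintype σ] [LinearOrder σ] (π : σ → Fin 6)
    (s : ℕ) (hs : 2 ≤ s) : HasLinearQuotients ((edgeIdeal K (gph π)) ^ s) := by
  classical
  rw [edge_pow]
  have hdeg : ∀ d, PP s (cs π d) → d.degree = 2 * s := fun d hd => (cs_total π d).trans hd.1
  let M : Finset (σ →₀ ℕ) :=
    (Finset.finsuppAntidiag Finset.univ (2 * s)).filter (fun d => PP s (cs π d))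
  have hM : ∀ d, d ∈ M ↔ PP s (cs π d) := by
    intro d
    simp only [M, Finset.mem_filter, Finset.mem_finsuppAntidiag, Finset.subset_univ, and_true,
      and_iff_right_iff_imp]
    intro h
    rw [← hdeg d h, Finsupp.degree_eq_sum]
  have hset : {d | PP s (cs π d)} = (M : Set (σ →₀ ℕ)) := by
    ext d; exact (hM d).symm
  rw [hset]
  let key : (σ →₀ ℕ) → KT ×ₗ (Lex (σ →₀ ℕ))ᵒᵈ :=
    fun d => toLex (KK s (cs π d), OrderDual.toDual (toLex d))
  refine lq_of_exchange M (2 * s) (fun d hd => hdeg d ((hM d).1 hd)) key ?_ ?_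
  · intro u _ v _ h
    simp only [key, EmbeddingLike.apply_eq_iff_eq, Prod.mk.injEq] at h
    exact h.2
  · intro u hu v hv h
    rw [hM] at hu hv
    simp only [key, Prod.Lex.toLex_lt_toLex, OrderDual.toDual_lt_toDual] at h
    obtain h | ⟨h, h'⟩ := h
    · obtain ⟨i, j, hij, hi, hj, hP, hK⟩ := exch s hs _ _ hu hv h
      obtain ⟨p, rfl, hp⟩ := cs_lt π v u i hi
      obtain ⟨q, rfl, hq⟩ := cs_pos π v j hj
      obtain ⟨e, he⟩ := exists_sub v q hq
      have hw : cs π (e + Finsupp.single p 1) = mv (cs π v) (π p) (π q) := by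
        funext k
        have : mv (cs π v) (π p) (π q) k = cs π v k + ind (π p) k - ind (π q) k := rfl
        rw [this, he, cs_add, cs_add, cs_single, cs_single]
        omega
      refine ⟨e + Finsupp.single p 1, ?_, ?_, p, hp, q, ?_⟩
      · rw [hM, hw]; exact hP
      · simp only [key, Prod.Lex.toLex_lt_toLex, hw]
        exact Or.inl hK
      · rw [he]; abel
    · have hcs := KK_inj s _ _ hu hv h
      obtain ⟨p, hpl, hp⟩ := Finsupp.Lex.lt_iff.1 h'
      simp only [ofLex_toLex] at hpl hp
      have hq : ∃ q, π q = π p ∧ u q < v q := by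
        by_contra hne
        push Not at hne
        have : cs π v (π p) < cs π u (π p) := by
          apply Finset.sum_lt_sum
          · intro i hi
            exact hne i (by simpa using hi)
          · exact ⟨p, by simp, hp⟩
        rw [hcs] at this
        exact lt_irrefl _ this
      obtain ⟨q, hqp, hq⟩ := hq
      obtain ⟨e, he⟩ := exists_sub v q (by omega)
      have hw : cs π (e + Finsupp.single p 1) = cs π v := by
        funext k
        rw [he, cs_add, cs_add, cs_single, cs_single, hqp]
      have hpq : p < q := by
        rcases lt_trichotomy p q with h1 | h1 | h1
        · exact h1
        · subst h1; omega
        · have := hpl q h1; omega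
      refine ⟨e + Finsupp.single p 1, ?_, ?_, p, hp, q, ?_⟩
      · rw [hM, hw]; exact hv
      · simp only [key, Prod.Lex.toLex_lt_toLex, hw, OrderDual.toDual_lt_toDual]
        refine Or.inr ⟨trivial, Finsupp.Lex.lt_iff.2 ⟨p, ?_, ?_⟩⟩
        · intro j hj
          simp only [ofLex_toLex]
          rw [he]
          simp [Finsupp.single_apply, hj.ne', (hj.trans hpq).ne']
        · simp only [ofLex_toLex]
          rw [he]
          simp [Finsupp.single_apply, hpq.ne']
      · rw [he]; abel

/-- the classes for `Fin n` -/
def pcl {n : ℕ} (i : Fin n) : Fin 6 := ⟨min i.1 5, by omega⟩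

lemma contains_of {V W : Type*} (G : SimpleGraph V) (H : SimpleGraph W) (f : W → V)
    (hf : Function.Injective f) (h : ∀ a b, H.Adj a b ↔ G.Adj (f a) (f b)) :
    ContainsInduced G H := by
  refine ⟨Set.range f, ⟨?_⟩⟩
  have e : H ≃g G.induce (Set.range f) :=
    { toEquiv := Equiv.ofInjective f hf
      map_rel_iff' := by
        intro a b
        simp [h] }
  exact e.symm

lemma contains_pcl {W : Type*} {n : ℕ} (hn : 7 ≤ n) (H : SimpleGraph W) (f : W → Fin 7)
    (hf : Function.Injective f) (h : ∀ a b, H.Adj a b ↔ wadj (pcl (f a)) (pcl (f b))) :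
    ContainsInduced (gph (pcl (n := n))) H :=
  contains_of _ _ (fun a => Fin.castLE hn (f a)) ((Fin.castLE_injective hn).comp hf)
    (fun a b => h a b)

set_option maxRecDepth 100000 in
set_option maxHeartbeats 2000000 in
lemma gapfree_cls : ∀ a b c d : Fin 6, wadj a b → wadj c d →
    wadj a c ∨ wadj a d ∨ wadj b c ∨ wadj b d := by
  decide

lemma cdcc {n : ℕ} (hn : 7 ≤ n) : IsCDCC (gph (pcl (n := n))) := by
  refine ⟨?_, ?_, ?_, ?_, ?_⟩
  · intro a b c d hab hcd _
    rcases gapfree_cls _ _ _ _ hab hcd with h | h | h | h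
    · exact ⟨a, c, h, ⟨a, by simp⟩, ⟨c, by simp⟩⟩
    · exact ⟨a, d, h, ⟨a, by simp⟩, ⟨d, by simp⟩⟩
    · exact ⟨b, c, h, ⟨b, by simp⟩, ⟨c, by simp⟩⟩
    · exact ⟨b, d, h, ⟨b, by simp⟩, ⟨d, by simp⟩⟩
  · refine contains_pcl hn _ ![5, 6, 0, 1, 4] (by decide) ?_
    simp only [cricket, SimpleGraph.fromRel_adj]
    decide
  · refine contains_pcl hn _ ![5, 6, 0, 2] (by decide) ?_
    simp only [diamond, SimpleGraph.deleteEdges_adj, SimpleGraph.top_adj, Set.mem_singleton_iff]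
    decide
  · refine contains_pcl hn _ ![5, 2, 6, 3] (by decide) ?_
    simp only [cycle4, SimpleGraph.fromRel_adj]
    decide
  · refine contains_pcl hn _ ![1, 3, 5, 2, 4] (by decide) ?_
    simp only [cycle5, SimpleGraph.fromRel_adj]
    decide

/-- for every `n ≥ 7` there is a CDCC graph on exactly `n` vertices all
of whose powers `I(Γ_n)^s`, `s ≥ 2`, have linear quotients. -/
theorem stmt16 {K : Type*} [Field K] (n : ℕ) (hn : 7 ≤ n) :
    ∃ Γ : SimpleGraph (Fin n), IsCDCC Γ ∧
      ∀ s : ℕ, 2 ≤ s → HasLinearQuotients ((edgeIdeal K Γ) ^ s) :=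
  ⟨gph pcl, cdcc hn, fun s hs => lq_main pcl s hs⟩
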